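/- For every tree τ ∈ T (with colors {0, A}) and every h ≥ 0, φ(τ)(h) = c(τ)·h^{ρ(τ)}, where ρ(τ) ∈ ℕ and c(τ) ∈ ℚ is given recursively by c(∅) = 1, c([∅]_A^q) = 1/q!, and c([[τ_1,…,τ_κ]_0]_A^q) = (r!/(q+r+1)!)·∏_{k=1}^κ c(τ_k) with r = ∑_{k=1}^κ ρ(τ_k). In particular c(τ) > 0 for all τ ∈ T. -/

import Mathlib

/-- The set `T` of `(M+2)`-colored rooted trees: `empty` is the empty tree `∅`,
`node m [τ₁,…,τ_κ]` is `[τ₁,…,τ_κ]_m` (root of color `m ∈ {0,…,M}`), and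
`nodeA τ₁` is `[τ₁]_A` (root of color `A`). -/
inductive CTree (M : ℕ) : Type
  | empty : CTree M
  | node  : Fin (M + 1) → List (CTree M) → CTree M
  | nodeA : CTree M → CTree M

namespace CTree

/-- The order `ρ(τ)` of a tree. -/
def rho {M : ℕ} : CTree M → ℚ
  | .empty => 0
  | .nodeA t => rho t + 1
  | .node m ts => (ts.attach.map (fun x => rho x.1)).sum + (if m = 0 then 1 else 1/2)
decreasing_by
  all_goals simp_wf
  all_goals (have h := List.sizeOf_lt_of_mem x.2; omega)

/-- The number of vertices `|τ|` of a tree. -/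
def size {M : ℕ} : CTree M → ℕ
  | .empty => 0
  | .nodeA t => size t + 1
  | .node _ ts => (ts.attach.map (fun x => size x.1)).sum + 1
decreasing_by
  all_goals simp_wf
  all_goals (have h := List.sizeOf_lt_of_mem x.2; omega)

/-- `r₁! ⋯ r_l!`, where `r₁,…,r_l` count the equal trees among the list `ts`. -/
noncomputable def symFactor {M : ℕ} (ts : List (CTree M)) : ℕ :=
  letI := Classical.decEq (CTree M)
  (ts.dedup.map fun t => (ts.count t).factorial).prod

/-- The coefficient `α(τ)`. -/
noncomputable def alpha {M : ℕ} : CTree M → ℚ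
  | .empty => 1
  | .nodeA t => alpha t
  | .node _ ts => (1 / (symFactor ts : ℚ)) * (ts.attach.map (fun x => alpha x.1)).prod
decreasing_by
  all_goals simp_wf
  all_goals (have h := List.sizeOf_lt_of_mem x.2; omega)

/-- `τ ∈ T ∖ T_A`, i.e. `τ = ∅` or `τ ∈ T_m` for some `m ∈ {0,…,M}`. -/
def notA {M : ℕ} (τ : CTree M) : Prop :=
  τ = CTree.empty ∨ ∃ (m : Fin (M + 1)) (ts : List (CTree M)), τ = CTree.node m ts

/-- The elementary differential `F(τ)(x₀)`, for coefficient functions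
`g_0,…,g_M : ℝ^d → ℝ^d` and a matrix `A ∈ ℝ^{d×d}`. -/
noncomputable def elemDiff {M d : ℕ} (g : Fin (M + 1) → (Fin d → ℝ) → (Fin d → ℝ))
    (A : Matrix (Fin d) (Fin d) ℝ) (x₀ : Fin d → ℝ) : CTree M → (Fin d → ℝ)
  | .empty => x₀
  | .nodeA t => A.mulVec (elemDiff g A x₀ t)
  | .node m ts =>
      iteratedFDeriv ℝ ts.length (g m) x₀
        (fun k => (ts.attach.map (fun x => elemDiff g A x₀ x.1)).getD k 0)
decreasing_by
  all_goals simp_wf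
  all_goals (have h := List.sizeOf_lt_of_mem x.2; omega)

end CTree

namespace CTree

/-- The order of a deterministic tree (colors `{0, A}`), as a natural number. -/
def rho0 : CTree 0 → ℕ
  | .empty => 0
  | .nodeA t => rho0 t + 1
  | .node _ ts => (ts.attach.map fun x => rho0 x.1).sum + 1
decreasing_by
  all_goals simp_wf
  all_goals (have h := List.sizeOf_lt_of_mem x.2; omega)

/-- Auxiliary weight function: `phiAux q τ̂ h = φ([τ̂]_A^q)(h)` for `τ̂ ∉ T_A`;
peeling roots of color `A` increments `q`, realizing the recursion
`φ(∅) ≡ 1`, `φ([∅]_A^q)(h) = h^q/q!`, and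
`φ([[τ₁,…,τ_κ]_0]_A^q)(h) = ∫₀ʰ ((h−s)^q/q!)·∏ φ(τ_k)(s) ds`. -/
noncomputable def phiAux : ℕ → CTree 0 → ℝ → ℝ
  | q, .empty, h => h ^ q / q.factorial
  | q, .nodeA t, h => phiAux (q + 1) t h
  | q, .node _ ts, h =>
      ∫ s in (0:ℝ)..h, ((h - s) ^ q / q.factorial) *
        (ts.attach.map (fun x => phiAux 0 x.1 s)).prod
termination_by q t h => sizeOf t
decreasing_by
  all_goals simp_wf
  all_goals (have h := List.sizeOf_lt_of_mem x.2; omega)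

/-- The weight function `φ(τ)` of the exact solution, deterministic case. -/
noncomputable def phiExact (τ : CTree 0) (h : ℝ) : ℝ := phiAux 0 τ h

/-- Auxiliary coefficient: `cAux q τ̂ = c([τ̂]_A^q)` for `τ̂ ∉ T_A`, realizing
`c(∅) = 1`, `c([∅]_A^q) = 1/q!`, and
`c([[τ₁,…,τ_κ]_0]_A^q) = (r!/(q+r+1)!)·∏ c(τ_k)` with `r = ∑ ρ(τ_k)`. -/
noncomputable def cAux : ℕ → CTree 0 → ℚ
  | q, .empty => 1 / q.factorial
  | q, .nodeA t => cAux (q + 1) t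
  | q, .node _ ts =>
      (((ts.map rho0).sum.factorial : ℚ) / ((q + (ts.map rho0).sum + 1).factorial : ℚ)) *
        (ts.attach.map fun x => cAux 0 x.1).prod
termination_by q t => sizeOf t
decreasing_by
  all_goals simp_wf
  all_goals (have h := List.sizeOf_lt_of_mem x.2; omega)

/-- The coefficient `c(τ)`. -/
noncomputable def cTree (τ : CTree 0) : ℚ := cAux 0 τ

end CTree

/-- The Euler beta integral with natural exponents, scaled to the interval `[0, h]`. -/
theorem integral_sub_pow_div_factorial_mul_pow (q r : ℕ) (h : ℝ) :
    ∫ s in (0 : ℝ)..h, (h - s) ^ q / q.factorial * s ^ r =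
      (r.factorial / (q + r + 1).factorial : ℝ) * h ^ (q + r + 1) := by
  induction q generalizing r with
  | zero =>
    have hr : (r.factorial : ℝ) ≠ 0 := by positivity
    simp only [pow_zero, Nat.factorial_zero, Nat.cast_one, div_one, one_mul, integral_pow,
      zero_add, Nat.factorial_succ]
    push_cast
    field_simp
    simp
  | succ q ih =>
    have hu (s : ℝ) : HasDerivAt (fun s ↦ (h - s) ^ (q + 1) / ((q + 1).factorial : ℝ))
        (-((h - s) ^ q / q.factorial)) s := by
      have hd := (((hasDerivAt_id s).const_sub h).fun_pow (q + 1)).div_const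
        ((q + 1).factorial : ℝ)
      refine hd.congr_deriv ?_
      rw [Nat.factorial_succ]
      push_cast
      simp only [id]
      field_simp
    have hv (s : ℝ) : HasDerivAt (fun s ↦ s ^ (r + 1) / ((r : ℝ) + 1)) (s ^ r) s := by
      have hd := (hasDerivAt_pow (r + 1) s).div_const ((r : ℝ) + 1)
      refine hd.congr_deriv ?_
      push_cast
      field_simp
    rw [intervalIntegral.integral_mul_deriv_eq_deriv_mul (fun s _ ↦ hu s) (fun s _ ↦ hv s)
      (Continuous.intervalIntegrable (by fun_prop) _ _)
      (Continuous.intervalIntegrable (by fun_prop) _ _)]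
    have hs (s : ℝ) : -((h - s) ^ q / (q.factorial : ℝ)) * (s ^ (r + 1) / ((r : ℝ) + 1)) =
        -(1 / ((r : ℝ) + 1)) * ((h - s) ^ q / q.factorial * s ^ (r + 1)) := by ring
    simp only [hs, intervalIntegral.integral_const_mul, ih]
    rw [show q + (r + 1) + 1 = q + 1 + r + 1 by ring, Nat.factorial_succ r]
    push_cast
    simp
    field_simp

namespace CTree

theorem phiAux_eq_cAux_mul_pow (q : ℕ) (τ : CTree 0) (h : ℝ) :
    phiAux q τ h = (cAux q τ : ℝ) * h ^ (q + rho0 τ) := by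
  induction q, τ, h using phiAux.induct with
  | case1 q h => simp [phiAux, cAux, rho0, div_eq_inv_mul]
  | case2 q t h ih =>
    rw [phiAux, cAux, rho0, ih, add_assoc, add_comm 1]
  | case3 q m ts h ih =>
    have hprod (s : ℝ) : (ts.attach.map fun x ↦ phiAux 0 x.1 s).prod =
        ((ts.attach.map fun x ↦ cAux 0 x.1).prod : ℚ) * s ^ (ts.map rho0).sum := by
      simp only [ih, zero_add]
      rw [← List.attach_map_val (l := ts) (f := rho0)]
      induction ts.attach with
      | nil => simp
      | cons x l ihl =>
        simp only [List.map_cons, List.prod_cons, List.sum_cons, ihl, Rat.cast_mul, pow_add]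
        ring
    rw [phiAux, cAux, rho0]
    simp only [hprod, List.attach_map_val (f := rho0)]
    generalize (ts.attach.map fun x ↦ cAux 0 x.1).prod = c
    simp only [mul_left_comm _ (c : ℝ), intervalIntegral.integral_const_mul,
      integral_sub_pow_div_factorial_mul_pow]
    push_cast
    ring

theorem cAux_pos (q : ℕ) (τ : CTree 0) : 0 < cAux q τ := by
  induction q, τ using cAux.induct with
  | case1 q => rw [cAux]; positivity
  | case2 q t ih => rwa [cAux]
  | case3 q m ts ih =>
    rw [cAux]
    refine mul_pos (by positivity) (List.prod_pos ?_)
    simp only [List.mem_map]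
    rintro _ ⟨x, -, rfl⟩
    exact ih x

end CTree

/-- For every tree `τ ∈ T` (colors `{0, A}`) and every `h ≥ 0`,
`φ(τ)(h) = c(τ)·h^{ρ(τ)}`; in particular `c(τ) > 0` for all `τ ∈ T`. -/
theorem phiExact_eq_c_mul_pow (τ : CTree 0) :
    (∀ h : ℝ, 0 ≤ h → CTree.phiExact τ h = (CTree.cTree τ : ℝ) * h ^ CTree.rho0 τ) ∧
    0 < CTree.cTree τ := by
  refine ⟨fun h _ ↦ ?_, CTree.cAux_pos 0 τ⟩
  simpa [CTree.phiExact, CTree.cTree] using CTree.phiAux_eq_cAux_mul_pow 0 τ h
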